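/- arXiv:1701.04482 — 2 statements merged into one kernel-verified Lean document; each statement's English description precedes it below -/
import Mathlib

section
/- Let a ≤ b be natural numbers and let m, j be natural numbers with m ≤ j ≤ 2m. Then C(a,j)·C(b,2m−j) ≤ C(a,m)·C(b,m). -/
theorem choose_succ_mul_choose_le {a b p q : ℕ} (hab : a ≤ b) (hqp : q ≤ p) :
    a.choose (p + 1) * b.choose q ≤ a.choose p * b.choose (q + 1) := by
  refine Nat.le_of_mul_le_mul_right ?_ p.succ_pos
  calc a.choose (p + 1) * b.choose q * (p + 1)
      = a.choose p * b.choose q * (a - p) := by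
        rw [mul_right_comm, Nat.choose_succ_right_eq, mul_right_comm]
    _ ≤ a.choose p * b.choose q * (b - q) := by gcongr
    _ = a.choose p * b.choose (q + 1) * (q + 1) := by
        rw [mul_assoc, mul_assoc, Nat.choose_succ_right_eq]
    _ ≤ a.choose p * b.choose (q + 1) * (p + 1) := by gcongr

/-- For natural numbers `a ≤ b` and `m ≤ j ≤ 2m`, `C(a,j)·C(b,2m−j) ≤ C(a,m)·C(b,m)`. -/
theorem choose_mul_choose_le (a b m j : ℕ) (hab : a ≤ b) (hmj : m ≤ j) (hj : j ≤ 2 * m) :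
    a.choose j * b.choose (2 * m - j) ≤ a.choose m * b.choose m := by
  induction j, hmj using Nat.le_induction with
  | base => rw [two_mul, Nat.add_sub_cancel]
  | succ j hmj ih =>
    refine le_trans ?_ (ih (by omega))
    have h : 2 * m - j = 2 * m - (j + 1) + 1 := by omega
    rw [h]
    exact choose_succ_mul_choose_le hab (by omega)
end

section
/- There exists p₀ > 0 such that for every p ∈ (0,p₀) and every λ ∈ (0,1), the ratio #ℬ̃^λ_p(N) / #𝒞_p(N) tends to 0 as N → +∞, where ℬ̃^λ_p(N) is the set of N-periodic spin systems in 𝒞_p(N) admitting a separating path of length at least λN whose vertices lie in z + [0,N]² for some z ∈ ℤ². -/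
open MeasureTheory ProbabilityTheory Filter

/-- Nearest neighbours in `ℤ²`: points at Euclidean (= ℓ¹) distance 1. -/
def NNbr (i j : ℤ × ℤ) : Prop := (i.1 - j.1).natAbs + (i.2 - j.2).natAbs = 1

/-- `γ : ℕ → ℤ × ℤ` defines a path of length `k`: consecutive points (up to index `k`) are
nearest neighbours, and the unordered pairs (bonds) traversed are pairwise distinct. -/
def IsPath (k : ℕ) (γ : ℕ → ℤ × ℤ) : Prop :=
  (∀ s < k, NNbr (γ s) (γ (s + 1))) ∧
  ∀ s < k, ∀ t < k, s ≠ t → s(γ s, γ (s + 1)) ≠ s(γ t, γ (t + 1))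

/-- The dual bond of a step from `i` to `j`: the pair of endpoints of the common side of the
unit squares `i + [0,1]²` and `j + [0,1]²` (when `i`, `j` are nearest neighbours). -/
def dualBond (i j : ℤ × ℤ) : Sym2 (ℤ × ℤ) :=
  s((max i.1 j.1, max i.2 j.2),
    (max i.1 j.1 + |i.2 - j.2|, max i.2 j.2 + |i.1 - j.1|))

/-- The number `μ(γ)` of antiferromagnetic bonds crossed by the path `γ` of length `k`,
for the spin configuration `c`. -/
def antiCount (c : Sym2 (ℤ × ℤ) → ℤ) (k : ℕ) (γ : ℕ → ℤ × ℤ) : ℕ :=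
  ((Finset.range k).filter fun s => c (dualBond (γ s) (γ (s + 1))) = -1).card

/-- An unordered pair of points of `ℤ²` is a bond if its two points are nearest neighbours. -/
def IsBond (e : Sym2 (ℤ × ℤ)) : Prop := ∃ i j : ℤ × ℤ, NNbr i j ∧ e = s(i, j)

/-- The set of bonds of `ℤ²`. -/
def Bond : Type := {e : Sym2 (ℤ × ℤ) // IsBond e}

/-- Extend a function defined on bonds to all unordered pairs, by the value 1 off the bonds. -/
noncomputable def extendBond (c : Bond → ℤ) : Sym2 (ℤ × ℤ) → ℤ := fun e => by
  classical exact if h : IsBond e then c ⟨e, h⟩ else 1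

/-- Membership in the square `[0,n]²`. -/
def InCube (n : ℕ) (v : ℤ × ℤ) : Prop :=
  0 ≤ v.1 ∧ v.1 ≤ (n : ℤ) ∧ 0 ≤ v.2 ∧ v.2 ≤ (n : ℤ)
/-- A spin system: `±1`-valued on bonds (normalized to `1` off the bonds). -/
def IsSpinSystem (c : Sym2 (ℤ × ℤ) → ℤ) : Prop :=
  ∀ e : Sym2 (ℤ × ℤ), (IsBond e → c e = 1 ∨ c e = -1) ∧ (¬IsBond e → c e = 1)

/-- `N`-periodicity of a spin system: invariance under the translations `(N,0)` and `(0,N)`. -/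
def IsPeriodicSpin (N : ℕ) (c : Sym2 (ℤ × ℤ) → ℤ) : Prop :=
  ∀ i j : ℤ × ℤ,
    c s(i + ((N : ℤ), 0), j + ((N : ℤ), 0)) = c s(i, j) ∧
    c s(i + (0, (N : ℤ)), j + (0, (N : ℤ))) = c s(i, j)

/-- The `2N²` bonds of the periodicity cell `[0,N]²`: one horizontal and one vertical bond
attached to each of the `N²` points of `[0,N)²`. -/
def cellBonds (N : ℕ) : Finset (Sym2 (ℤ × ℤ)) :=
  ((Finset.range N ×ˢ Finset.range N).image fun q =>
      s(((q.1 : ℤ), (q.2 : ℤ)), ((q.1 : ℤ) + 1, (q.2 : ℤ)))) ∪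
  ((Finset.range N ×ˢ Finset.range N).image fun q =>
      s(((q.1 : ℤ), (q.2 : ℤ)), ((q.1 : ℤ), (q.2 : ℤ) + 1)))

/-- `𝒞_p(N)`: the set of `N`-periodic spin systems with exactly `⌊2pN²⌋` antiferromagnetic
bonds in the periodicity cell `[0,N]²`. -/
def spinClass (p : ℝ) (N : ℕ) : Set (Sym2 (ℤ × ℤ) → ℤ) :=
  {c | IsSpinSystem c ∧ IsPeriodicSpin N c ∧
    ((cellBonds N).filter fun e => c e = -1).card = ⌊2 * p * (N : ℝ) ^ 2⌋₊}

/-- Membership in the square `z + [0,N]²`. -/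
def InSquare (z : ℤ × ℤ) (N : ℕ) (v : ℤ × ℤ) : Prop :=
  z.1 ≤ v.1 ∧ v.1 ≤ z.1 + (N : ℤ) ∧ z.2 ≤ v.2 ∧ v.2 ≤ z.2 + (N : ℤ)

/-- `ℬ^λ_p(N)`: the spin systems of `𝒞_p(N)` admitting a separating path of length `≥ λN`
with all vertices in `[0,N]²`. -/
def badClass (p lam : ℝ) (N : ℕ) : Set (Sym2 (ℤ × ℤ) → ℤ) :=
  {c | c ∈ spinClass p N ∧ ∃ k, ∃ γ : ℕ → ℤ × ℤ, IsPath k γ ∧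
    (∀ s ≤ k, InSquare (0, 0) N (γ s)) ∧ lam * (N : ℝ) ≤ (k : ℝ) ∧
    (k : ℝ) / 2 < (antiCount c k γ : ℝ)}

/-- `ℬ̃^λ_p(N)`: the spin systems of `𝒞_p(N)` admitting a separating path of length `≥ λN`
with all vertices in `z + [0,N]²` for some `z ∈ ℤ²`. -/
def badClassTrans (p lam : ℝ) (N : ℕ) : Set (Sym2 (ℤ × ℤ) → ℤ) :=
  {c | c ∈ spinClass p N ∧ ∃ z : ℤ × ℤ, ∃ k, ∃ γ : ℕ → ℤ × ℤ, IsPath k γ ∧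
    (∀ s ≤ k, InSquare z N (γ s)) ∧ lam * (N : ℝ) ≤ (k : ℝ) ∧
    (k : ℝ) / 2 < (antiCount c k γ : ℝ)}

/-- The unit vector of `R²` in the horizontal (`true`) or vertical (`false`) direction. -/
def unitVec (R : Type*) [Zero R] [One R] (d : Bool) : R × R := if d then (1, 0) else (0, 1)

/-- The bond issuing from `x` in the direction `d`. -/
def bondAt (x : ℤ × ℤ) (d : Bool) : Sym2 (ℤ × ℤ) := s(x, x + unitVec ℤ d)

/-- Bonds of the discrete torus of side `N`: a base vertex and a direction. -/
abbrev TorusBond (N : ℕ) : Type := (ZMod N × ZMod N) × Bool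

/-- Reduction of a vertex modulo `N`. -/
def toTorus (N : ℕ) (x : ℤ × ℤ) : ZMod N × ZMod N := (x.1, x.2)

/-- The representative in `[0,N)²` of a vertex of the torus. -/
def torusRep {N : ℕ} (v : ZMod N × ZMod N) : ℤ × ℤ := ((v.1.val : ℤ), (v.2.val : ℤ))

open Classical in
/-- The periodic spin system whose antiferromagnetic bonds are those reducing to `A`. -/
noncomputable def spinOf {N : ℕ} (A : Finset (TorusBond N)) (e : Sym2 (ℤ × ℤ)) : ℤ :=
  if ∃ x d, e = bondAt x d ∧ (toTorus N x, d) ∈ A then -1 else 1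

lemma bondAt_inj {x y : ℤ × ℤ} {d d' : Bool} : bondAt x d = bondAt y d' ↔ x = y ∧ d = d' := by
  obtain ⟨a, b⟩ := x
  obtain ⟨a', b'⟩ := y
  cases d <;> cases d' <;> simp [bondAt, unitVec] <;> omega

lemma isBond_iff {e : Sym2 (ℤ × ℤ)} : IsBond e ↔ ∃ x d, e = bondAt x d := by
  constructor
  · rintro ⟨⟨a, b⟩, ⟨a', b'⟩, h, rfl⟩
    simp only [NNbr] at h
    have h4 : (a' = a + 1 ∧ b' = b) ∨ (a = a' + 1 ∧ b' = b) ∨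
        (a' = a ∧ b' = b + 1) ∨ (a' = a ∧ b = b' + 1) := by omega
    rcases h4 with ⟨rfl, rfl⟩ | ⟨rfl, rfl⟩ | ⟨rfl, rfl⟩ | ⟨rfl, rfl⟩
    · exact ⟨(a, b'), true, by simp [bondAt, unitVec]⟩
    · exact ⟨(a', b'), true, by rw [Sym2.eq_swap]; simp [bondAt, unitVec]⟩
    · exact ⟨(a', b), false, by simp [bondAt, unitVec]⟩
    · exact ⟨(a', b'), false, by rw [Sym2.eq_swap]; simp [bondAt, unitVec]⟩
  · rintro ⟨⟨a, b⟩, d, rfl⟩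
    exact ⟨_, _, by cases d <;> simp [NNbr, unitVec], rfl⟩

lemma spinOf_bondAt {N : ℕ} (A : Finset (TorusBond N)) (x : ℤ × ℤ) (d : Bool) :
    spinOf A (bondAt x d) = if (toTorus N x, d) ∈ A then -1 else 1 := by
  unfold spinOf
  congr 1
  simp only [bondAt_inj, eq_iff_iff]
  constructor
  · rintro ⟨y, d', ⟨rfl, rfl⟩, h⟩
    exact h
  · exact fun h => ⟨x, d, ⟨rfl, rfl⟩, h⟩

lemma spinOf_bondAt_eq_neg_one {N : ℕ} (A : Finset (TorusBond N)) (x : ℤ × ℤ) (d : Bool) :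
    spinOf A (bondAt x d) = -1 ↔ (toTorus N x, d) ∈ A := by
  rw [spinOf_bondAt]
  split_ifs with h <;> simp [h]

lemma isSpinSystem_spinOf {N : ℕ} (A : Finset (TorusBond N)) : IsSpinSystem (spinOf A) := by
  refine fun e => ⟨fun _ => ?_, fun h => ?_⟩
  · unfold spinOf
    split_ifs <;> simp
  · unfold spinOf
    rw [if_neg]
    rintro ⟨x, d, rfl, -⟩
    exact h (isBond_iff.2 ⟨x, d, rfl⟩)

lemma spinOf_translate {N : ℕ} (A : Finset (TorusBond N)) {w : ℤ × ℤ} (hw : toTorus N w = 0)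
    (i j : ℤ × ℤ) : spinOf A s(i + w, j + w) = spinOf A s(i, j) := by
  have hw' : ((w.1 : ZMod N) = 0) ∧ ((w.2 : ZMod N) = 0) := by
    simpa [toTorus, Prod.ext_iff] using hw
  have key : ∀ x d, s(i + w, j + w) = bondAt (x + w) d ↔ s(i, j) = bondAt x d := by
    intro x d
    simp only [bondAt, Sym2.eq_iff, add_left_inj, add_right_comm x w]
  unfold spinOf
  congr 1
  rw [eq_iff_iff]
  constructor
  · rintro ⟨x, d, h, hA⟩
    refine ⟨x - w, d, (key _ _).1 (by simpa using h), ?_⟩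
    simpa [toTorus, hw'.1, hw'.2] using hA
  · rintro ⟨x, d, h, hA⟩
    refine ⟨x + w, d, (key _ _).2 h, ?_⟩
    simpa [toTorus, hw'.1, hw'.2] using hA

lemma isPeriodicSpin_spinOf {N : ℕ} (A : Finset (TorusBond N)) :
    IsPeriodicSpin N (spinOf A) := fun i j =>
  ⟨spinOf_translate A (by simp [toTorus]) i j, spinOf_translate A (by simp [toTorus]) i j⟩

lemma toTorus_torusRep {N : ℕ} [NeZero N] (v : ZMod N × ZMod N) :
    toTorus N (torusRep v) = v := by
  simp [toTorus, torusRep]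

lemma IsPeriodicSpin.apply_torusRep {N : ℕ} [NeZero N] {c : Sym2 (ℤ × ℤ) → ℤ}
    (hc : IsPeriodicSpin N c) (x : ℤ × ℤ) (d : Bool) :
    c (bondAt (torusRep (toTorus N x)) d) = c (bondAt x d) := by
  have h1 : ∀ b, Function.Periodic (fun a : ℤ => c (bondAt (a, b) d)) (N : ℤ) := by
    intro b a
    have := (hc (a, b) ((a, b) + unitVec ℤ d)).1
    rw [add_right_comm] at this
    simpa [bondAt] using this
  have h2 : ∀ a, Function.Periodic (fun b : ℤ => c (bondAt (a, b) d)) (N : ℤ) := by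
    intro a b
    have := (hc (a, b) ((a, b) + unitVec ℤ d)).2
    rw [add_right_comm] at this
    simpa [bondAt] using this
  obtain ⟨a, b⟩ := x
  simp only [torusRep, toTorus, ZMod.val_intCast]
  rw [Int.emod_def, Int.emod_def, mul_comm, mul_comm _ (b / _)]
  exact (Function.Periodic.sub_zsmul_eq (h1 _) (a / N)).trans
    (Function.Periodic.sub_zsmul_eq (h2 _) (b / N))

/-- The antiferromagnetic bonds of a spin system, as bonds of the torus. -/
def antiBonds (N : ℕ) [NeZero N] (c : Sym2 (ℤ × ℤ) → ℤ) : Finset (TorusBond N) :=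
  Finset.univ.filter fun t => c (bondAt (torusRep t.1) t.2) = -1

lemma spinOf_antiBonds {N : ℕ} [NeZero N] {c : Sym2 (ℤ × ℤ) → ℤ} (hs : IsSpinSystem c)
    (hc : IsPeriodicSpin N c) : spinOf (antiBonds N c) = c := by
  funext e
  by_cases he : IsBond e
  · have h := (hs e).1 he
    obtain ⟨x, d, rfl⟩ := isBond_iff.1 he
    rw [spinOf_bondAt]
    simp only [antiBonds, Finset.mem_filter, Finset.mem_univ, true_and, hc.apply_torusRep]
    split_ifs with h' <;> grind
  · rw [(hs e).2 he, (isSpinSystem_spinOf _ e).2 he]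

lemma antiBonds_spinOf {N : ℕ} [NeZero N] (A : Finset (TorusBond N)) :
    antiBonds N (spinOf A) = A := by
  ext ⟨v, d⟩
  simp [antiBonds, spinOf_bondAt_eq_neg_one, toTorus_torusRep]

lemma cellBonds_eq_image (N : ℕ) [NeZero N] :
    cellBonds N = (Finset.univ : Finset (TorusBond N)).image fun t =>
      bondAt (torusRep t.1) t.2 := by
  ext e
  simp only [cellBonds, Finset.mem_union, Finset.mem_image, Finset.mem_product, Finset.mem_range,
    Finset.mem_univ, true_and]
  constructor
  · rintro (⟨⟨a, b⟩, ⟨ha, hb⟩, rfl⟩ | ⟨⟨a, b⟩, ⟨ha, hb⟩, rfl⟩)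
    · exact ⟨((a, b), true), by
        simp [bondAt, torusRep, unitVec, ZMod.val_natCast_of_lt ha, ZMod.val_natCast_of_lt hb]⟩
    · exact ⟨((a, b), false), by
        simp [bondAt, torusRep, unitVec, ZMod.val_natCast_of_lt ha, ZMod.val_natCast_of_lt hb]⟩
  · rintro ⟨⟨⟨a, b⟩, d⟩, rfl⟩
    cases d
    · exact Or.inr ⟨(a.val, b.val), ⟨a.val_lt, b.val_lt⟩, by simp [bondAt, torusRep, unitVec]⟩
    · exact Or.inl ⟨(a.val, b.val), ⟨a.val_lt, b.val_lt⟩, by simp [bondAt, torusRep, unitVec]⟩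

lemma card_antiBonds (N : ℕ) [NeZero N] (c : Sym2 (ℤ × ℤ) → ℤ) :
    ((cellBonds N).filter fun e => c e = -1).card = (antiBonds N c).card := by
  rw [cellBonds_eq_image, Finset.filter_image, Finset.card_image_of_injective, antiBonds]
  rintro ⟨v, d⟩ ⟨v', d'⟩ h
  obtain ⟨h, rfl⟩ := bondAt_inj.1 h
  rw [← toTorus_torusRep v, ← toTorus_torusRep v', h]

lemma spinClass_eq_image (p : ℝ) (N : ℕ) [NeZero N] :
    spinClass p N = spinOf '' (Finset.powersetCard ⌊2 * p * (N : ℝ) ^ 2⌋₊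
      (Finset.univ : Finset (TorusBond N)) : Set (Finset (TorusBond N))) := by
  ext c
  simp only [spinClass, Set.mem_ofPred_eq, Set.mem_image, Finset.mem_coe, Finset.mem_powersetCard,
    Finset.subset_univ, true_and, card_antiBonds]
  constructor
  · rintro ⟨hs, hc, h⟩
    exact ⟨_, h, spinOf_antiBonds hs hc⟩
  · rintro ⟨A, hA, rfl⟩
    exact ⟨isSpinSystem_spinOf A, isPeriodicSpin_spinOf A, by rwa [antiBonds_spinOf]⟩

lemma card_torusBond (N : ℕ) [NeZero N] : Fintype.card (TorusBond N) = 2 * N ^ 2 := by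
  simp [ZMod.card]
  ring

lemma card_spinClass (p : ℝ) (N : ℕ) [NeZero N] :
    Nat.card (spinClass p N) = (2 * N ^ 2).choose ⌊2 * p * (N : ℝ) ^ 2⌋₊ := by
  rw [Nat.card_coe_set_eq, spinClass_eq_image, Set.ncard_image_of_injective, Set.ncard_coe_finset,
    Finset.card_powersetCard, Finset.card_univ, card_torusBond]
  exact Function.LeftInverse.injective antiBonds_spinOf

/-- The torus bond crossed by a step from `i` to `j`. -/
def crossedBond (N : ℕ) (i j : ℤ × ℤ) : TorusBond N :=
  (toTorus N (max i.1 j.1, max i.2 j.2), decide (i.1 = j.1))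

lemma dualBond_eq_bondAt {i j : ℤ × ℤ} (h : NNbr i j) :
    dualBond i j = bondAt (max i.1 j.1, max i.2 j.2) (decide (i.1 = j.1)) := by
  obtain ⟨a, b⟩ := i
  obtain ⟨a', b'⟩ := j
  simp only [NNbr] at h
  by_cases hab : a = a'
  · subst hab
    have : |b - b'| = 1 := by rw [Int.abs_eq_natAbs]; omega
    simp [dualBond, bondAt, unitVec, this]
  · have h1 : |a - a'| = 1 := by rw [Int.abs_eq_natAbs]; omega
    have h2 : b = b' := by omega
    simp [dualBond, bondAt, unitVec, hab, h1, h2]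

/-- The vertex reached from `v` by a step in direction `q.1`, forwards if `q.2`. -/
def stepTo {N : ℕ} (v : ZMod N × ZMod N) (q : Bool × Bool) : ZMod N × ZMod N :=
  if q.2 then v + unitVec _ q.1 else v - unitVec _ q.1

/-- The torus bond crossed by the step `q` from `v`. -/
def stepBond {N : ℕ} (v : ZMod N × ZMod N) (q : Bool × Bool) : TorusBond N :=
  (if q.2 then v + unitVec _ q.1 else v, !q.1)

lemma exists_step (N : ℕ) {i j : ℤ × ℤ} (h : NNbr i j) :
    ∃ q, toTorus N j = stepTo (toTorus N i) q ∧ crossedBond N i j = stepBond (toTorus N i) q := by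
  obtain ⟨a, b⟩ := i
  obtain ⟨a', b'⟩ := j
  simp only [NNbr] at h
  have h4 : (a' = a + 1 ∧ b' = b) ∨ (a = a' + 1 ∧ b' = b) ∨
      (a' = a ∧ b' = b + 1) ∨ (a' = a ∧ b = b' + 1) := by omega
  rcases h4 with ⟨rfl, rfl⟩ | ⟨rfl, rfl⟩ | ⟨rfl, rfl⟩ | ⟨rfl, rfl⟩
  · exact ⟨(true, true), by simp [toTorus, stepTo, stepBond, crossedBond, unitVec]⟩
  · exact ⟨(true, false), by simp [toTorus, stepTo, stepBond, crossedBond, unitVec]⟩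
  · exact ⟨(false, true), by simp [toTorus, stepTo, stepBond, crossedBond, unitVec]⟩
  · exact ⟨(false, false), by simp [toTorus, stepTo, stepBond, crossedBond, unitVec]⟩

/-- The sets of torus bonds obtained by selecting some of the bonds crossed by a walk of `k` steps
from `v`. -/
def crossingSets {N : ℕ} : ℕ → ZMod N × ZMod N → Finset (Finset (TorusBond N))
  | 0, _ => {∅}
  | k + 1, v => (Finset.univ : Finset ((Bool × Bool) × Bool)).biUnion fun q =>
      (crossingSets k (stepTo v q.1)).image fun J => if q.2 then insert (stepBond v q.1) J else J

lemma card_crossingSets_le {N : ℕ} (k : ℕ) (v : ZMod N × ZMod N) :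
    (crossingSets k v).card ≤ 8 ^ k := by
  induction k generalizing v with
  | zero => simp [crossingSets]
  | succ k ih =>
    rw [crossingSets, pow_succ']
    exact Finset.card_biUnion_le_card_mul _ _ _ fun q _ => Finset.card_image_le.trans (ih _)

lemma image_crossedBond_mem_crossingSets (N : ℕ) (P : ℤ × ℤ → ℤ × ℤ → Prop)
    [∀ i j, Decidable (P i j)] (k : ℕ) (γ : ℕ → ℤ × ℤ) (h : ∀ s < k, NNbr (γ s) (γ (s + 1))) :
    ((Finset.range k).filter fun s => P (γ s) (γ (s + 1))).image
      (fun s => crossedBond N (γ s) (γ (s + 1))) ∈ crossingSets k (toTorus N (γ 0)) := by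
  induction k generalizing γ with
  | zero => simp [crossingSets]
  | succ k ih =>
    have ih' := ih (fun s => γ (s + 1)) fun s hs => h (s + 1) (by omega)
    obtain ⟨q, hq1, hq2⟩ := exists_step N (h 0 (by omega))
    rw [crossingSets, Finset.mem_biUnion]
    refine ⟨(q, decide (P (γ 0) (γ 1))), Finset.mem_univ _, Finset.mem_image.2 ⟨_, hq1 ▸ ih', ?_⟩⟩
    rw [Finset.range_add_one', Finset.filter_insert, Finset.filter_map]
    dsimp only
    rw [← hq2]
    by_cases hP : P (γ 0) (γ 1)
    · simp [hP, Finset.image_insert, Finset.map_eq_image, Finset.image_image, Function.comp_def]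
      rfl
    · simp [hP, Finset.map_eq_image, Finset.image_image, Function.comp_def]
      rfl

lemma eq_of_intCast_eq {N : ℕ} {z a b : ℤ} (h : (a : ZMod N) = b) (ha : z ≤ a) (ha' : a ≤ z + N)
    (hb : z ≤ b) (hb' : b ≤ z + N) (hz : a = z ↔ b = z) : a = b := by
  rw [ZMod.intCast_eq_intCast_iff_dvd_sub] at h
  by_contra hne
  have h1 := Int.le_of_dvd (a := (N : ℤ)) (b := |b - a|) (by grind) ((dvd_abs _ _).2 h)
  grind

lemma edge_eq_of_crossedBond_eq {N : ℕ} {z i j i' j' : ℤ × ℤ} (h : NNbr i j) (h' : NNbr i' j')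
    (hi : InSquare z N i) (hj : InSquare z N j) (hi' : InSquare z N i') (hj' : InSquare z N j')
    (hc : crossedBond N i j = crossedBond N i' j')
    (hz : (max i.1 j.1 = z.1 ∨ max i.2 j.2 = z.2) ↔ (max i'.1 j'.1 = z.1 ∨ max i'.2 j'.2 = z.2)) :
    s(i, j) = s(i', j') := by
  simp only [crossedBond, toTorus, Prod.mk.injEq, decide_eq_decide] at hc
  obtain ⟨⟨hc1, hc2⟩, hd⟩ := hc
  simp only [InSquare] at hi hj hi' hj'
  simp only [NNbr] at h h'
  have e1 := eq_of_intCast_eq (z := z.1) hc1 (by omega) (by omega) (by omega) (by omega)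
    (by omega)
  have e2 := eq_of_intCast_eq (z := z.2) hc2 (by omega) (by omega) (by omega) (by omega)
    (by omega)
  rw [Sym2.eq_iff, Prod.ext_iff, Prod.ext_iff, Prod.ext_iff, Prod.ext_iff]
  omega

lemma card_le_two_mul_card_image_crossedBond {N k : ℕ} {z : ℤ × ℤ} {γ : ℕ → ℤ × ℤ}
    (hγ : IsPath k γ) (hz : ∀ s ≤ k, InSquare z N (γ s)) {S : Finset ℕ}
    (hS : S ⊆ Finset.range k) :
    S.card ≤ 2 * (S.image fun s => crossedBond N (γ s) (γ (s + 1))).card := by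
  refine Finset.card_le_mul_card_image S 2 fun t _ => ?_
  rw [← Fintype.card_bool, ← Finset.card_univ]
  refine Finset.card_le_card_of_injOn (fun s => decide (max (γ s).1 (γ (s + 1)).1 = z.1 ∨
    max (γ s).2 (γ (s + 1)).2 = z.2)) (fun _ _ => Finset.mem_univ _) ?_
  intro s hs s' hs' hss
  simp only [Finset.coe_filter, Set.mem_ofPred_eq] at hs hs'
  have hk := Finset.mem_range.1 (hS hs.1)
  have hk' := Finset.mem_range.1 (hS hs'.1)
  by_contra hne
  exact hγ.2 s hk s' hk' hne (edge_eq_of_crossedBond_eq (hγ.1 s hk) (hγ.1 s' hk')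
    (hz _ hk.le) (hz _ hk) (hz _ hk'.le) (hz _ hk') (hs.2.trans hs'.2.symm)
    (decide_eq_decide.1 hss))

lemma exists_crossingSet_of_mem_badClassTrans {p lam : ℝ} {N : ℕ} [NeZero N]
    {c : Sym2 (ℤ × ℤ) → ℤ} (hc : c ∈ badClassTrans p lam N) :
    ∃ k v, ∃ J ∈ crossingSets k v, lam * (N : ℝ) ≤ (k : ℝ) ∧ k < 4 * J.card ∧
      J ⊆ antiBonds N c := by
  obtain ⟨⟨-, hper, -⟩, z, k, γ, hγ, hz, hk, hanti⟩ := hc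
  refine ⟨k, _, _, image_crossedBond_mem_crossingSets N (fun i j => c (dualBond i j) = -1) k γ hγ.1,
    hk, ?_, ?_⟩
  · have h1 := card_le_two_mul_card_image_crossedBond hγ hz
      (Finset.filter_subset (fun s => c (dualBond (γ s) (γ (s + 1))) = -1) (Finset.range k))
    have h2 : k < 2 * antiCount c k γ := by
      have : (k : ℝ) < 2 * antiCount c k γ := by linarith
      exact_mod_cast this
    unfold antiCount at h2
    omega
  · intro t ht
    obtain ⟨s, hs, rfl⟩ := Finset.mem_image.1 ht
    obtain ⟨hs, hcs⟩ := Finset.mem_filter.1 hs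
    rw [dualBond_eq_bondAt (hγ.1 s (Finset.mem_range.1 hs))] at hcs
    simpa [antiBonds, crossedBond, hper.apply_torusRep] using hcs

lemma choose_sub_sub_le {p : ℝ} (hp0 : 0 ≤ p) (hp1 : p ≤ 1) {j m M : ℕ} (hj : j ≤ m)
    (hm : (m : ℝ) ≤ p * M) : ((M - j).choose (m - j) : ℝ) ≤ p ^ j * M.choose m := by
  induction j generalizing m M with
  | zero => simp
  | succ j ih =>
    obtain ⟨m, rfl⟩ : ∃ m', m = m' + 1 := ⟨m - 1, by omega⟩
    obtain _ | M := M
    · norm_num at hm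
      have : (0 : ℝ) ≤ m := m.cast_nonneg
      linarith
    push_cast at hm
    have h1 := ih (m := m) (M := M) (by omega) (by linarith)
    have h2 : ((M : ℝ) + 1) * M.choose m = (M + 1).choose (m + 1) * (m + 1) := by
      exact_mod_cast Nat.add_one_mul_choose_eq M m
    have h3 : (M.choose m : ℝ) ≤ p * (M + 1).choose (m + 1) := by
      have hM : (0 : ℝ) < (M : ℝ) + 1 := by positivity
      refine le_of_mul_le_mul_left ?_ hM
      rw [h2]
      nlinarith [((M + 1).choose (m + 1)).cast_nonneg (α := ℝ)]
    rw [Nat.add_sub_add_right, Nat.add_sub_add_right, pow_succ, mul_assoc]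
    exact h1.trans (mul_le_mul_of_nonneg_left h3 (by positivity))

lemma card_powersetCard_filter_superset_le {α : Type*} [Fintype α] [DecidableEq α] {p : ℝ}
    (hp0 : 0 ≤ p) (hp1 : p ≤ 1) (J : Finset α) {m : ℕ} (hm : (m : ℝ) ≤ p * Fintype.card α) :
    (((Finset.powersetCard m Finset.univ).filter (J ⊆ ·)).card : ℝ) ≤
      p ^ J.card * (Fintype.card α).choose m := by
  by_cases hJ : J.card ≤ m
  · refine le_trans ?_ (choose_sub_sub_le hp0 hp1 hJ hm)
    rw [← Finset.card_compl, ← Finset.card_powersetCard]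
    norm_cast
    refine Finset.card_le_card_of_injOn (· \ J) ?_ ?_
    · intro A hA
      simp only [Finset.coe_filter, Finset.mem_powersetCard, Set.mem_ofPred_eq] at hA
      rw [Finset.mem_coe, Finset.mem_powersetCard]
      refine ⟨fun x hx => by simp_all, ?_⟩
      rw [Finset.card_sdiff_of_subset hA.2, hA.1.2]
    · intro A hA B hB h
      simp only [Finset.coe_filter, Finset.mem_powersetCard, Set.mem_ofPred_eq] at hA hB
      rw [← Finset.sdiff_union_of_subset hA.2, ← Finset.sdiff_union_of_subset hB.2]
      exact congrArg (· ∪ J) h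
  · rw [Finset.filter_false_of_mem]
    · simp only [Finset.card_empty, Nat.cast_zero]
      positivity
    · intro A hA hJA
      have := Finset.card_le_card hJA
      rw [Finset.mem_powersetCard] at hA
      omega

/-- The sets of `m` torus bonds containing a crossing set that witnesses a separating path of
length at least `L`. -/
def badBondSets (N : ℕ) [NeZero N] (m L : ℕ) : Finset (Finset (TorusBond N)) :=
  (Finset.Ico L (8 * N ^ 2)).biUnion fun k => Finset.univ.biUnion fun v =>
    ((crossingSets k v).filter fun J => k ≤ 4 * J.card).biUnion fun J =>
      (Finset.powersetCard m Finset.univ).filter (J ⊆ ·)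

lemma badClassTrans_subset_image (p lam : ℝ) (N : ℕ) [NeZero N] :
    badClassTrans p lam N ⊆
      spinOf '' (badBondSets N ⌊2 * p * (N : ℝ) ^ 2⌋₊ ⌈lam * N⌉₊ : Set (Finset (TorusBond N))) := by
  intro c hc
  obtain ⟨k, v, J, hJ, hk, hkJ, hJc⟩ := exists_crossingSet_of_mem_badClassTrans hc
  obtain ⟨⟨hs, hper, hcard⟩, -⟩ := hc
  refine ⟨antiBonds N c, ?_, spinOf_antiBonds hs hper⟩
  rw [card_antiBonds] at hcard
  have hJT : J.card ≤ 2 * N ^ 2 := card_torusBond N ▸ J.card_le_univ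
  simp only [badBondSets, Finset.mem_coe, Finset.mem_biUnion, Finset.mem_Ico, Finset.mem_univ,
    true_and, Finset.mem_filter, Finset.mem_powersetCard, Finset.subset_univ]
  exact ⟨k, ⟨Nat.ceil_le.2 hk, by omega⟩, v, J, ⟨hJ, hkJ.le⟩, hcard, hJc⟩

lemma card_badBondSets_le {p : ℝ} (hp0 : 0 ≤ p) (hp : p ≤ 1 / 16 ^ 4) (N : ℕ) [NeZero N]
    {m : ℕ} (L : ℕ) (hm : (m : ℝ) ≤ p * (2 * N ^ 2 : ℕ)) :
    ((badBondSets N m L).card : ℝ) ≤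
      8 * N ^ 4 * (1 / 2) ^ L * (2 * N ^ 2).choose m := by
  set C : ℝ := (2 * N ^ 2).choose m with hC
  have hC0 : 0 ≤ C := by positivity
  have hsets : ∀ k v, ((((crossingSets k v).filter fun J => k ≤ 4 * J.card).biUnion fun J =>
      (Finset.powersetCard m (Finset.univ : Finset (TorusBond N))).filter (J ⊆ ·)).card : ℝ) ≤
      (1 / 2) ^ k * C := by
    intro k v
    calc _ ≤ ∑ J ∈ (crossingSets k v).filter (fun J => k ≤ 4 * J.card),
          (((Finset.powersetCard m (Finset.univ : Finset (TorusBond N))).filter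
            (J ⊆ ·)).card : ℝ) := by exact_mod_cast Finset.card_biUnion_le
      _ ≤ ∑ J ∈ (crossingSets k v).filter (fun J => k ≤ 4 * J.card), (1 / 16) ^ k * C := by
          refine Finset.sum_le_sum fun J hJ => ?_
          have h1 := card_powersetCard_filter_superset_le hp0 (hp.trans (by norm_num)) J
            (m := m) (by rwa [card_torusBond])
          rw [card_torusBond] at h1
          refine h1.trans (mul_le_mul_of_nonneg_right ?_ hC0)
          calc p ^ J.card ≤ (1 / 16 ^ 4) ^ J.card := pow_le_pow_left₀ hp0 hp _
            _ = (1 / 16) ^ (4 * J.card) := by rw [pow_mul]; norm_num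
            _ ≤ (1 / 16) ^ k := pow_le_pow_of_le_one (by norm_num) (by norm_num)
                (Finset.mem_filter.1 hJ).2
      _ ≤ 8 ^ k * ((1 / 16) ^ k * C) := by
          rw [Finset.sum_const, nsmul_eq_mul]
          refine mul_le_mul_of_nonneg_right ?_ (by positivity)
          exact_mod_cast (Finset.card_filter_le _ _).trans (card_crossingSets_le k v)
      _ = (1 / 2) ^ k * C := by rw [← mul_assoc, ← mul_pow]; norm_num
  have hstart : ∀ k ∈ Finset.Ico L (8 * N ^ 2),
      (((Finset.univ.biUnion fun v => ((crossingSets k v).filter fun J => k ≤ 4 * J.card).biUnion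
        fun J => (Finset.powersetCard m (Finset.univ : Finset (TorusBond N))).filter
          (J ⊆ ·)).card : ℕ) : ℝ) ≤ N ^ 2 * ((1 / 2) ^ L * C) := by
    intro k hk
    calc _ ≤ ∑ v : ZMod N × ZMod N, ((((crossingSets k v).filter
          fun J => k ≤ 4 * J.card).biUnion fun J => (Finset.powersetCard m
            (Finset.univ : Finset (TorusBond N))).filter (J ⊆ ·)).card : ℝ) := by
          exact_mod_cast Finset.card_biUnion_le
      _ ≤ ∑ v : ZMod N × ZMod N, (1 / 2) ^ L * C := by
          refine Finset.sum_le_sum fun v _ => (hsets k v).trans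
            (mul_le_mul_of_nonneg_right ?_ hC0)
          exact pow_le_pow_of_le_one (by norm_num) (by norm_num) (Finset.mem_Ico.1 hk).1
      _ = N ^ 2 * ((1 / 2) ^ L * C) := by
          rw [Finset.sum_const, Finset.card_univ, Fintype.card_prod, ZMod.card, nsmul_eq_mul,
            ← sq, Nat.cast_pow]
  calc ((badBondSets N m L).card : ℝ)
      ≤ ∑ k ∈ Finset.Ico L (8 * N ^ 2), (((Finset.univ.biUnion fun v =>
        ((crossingSets k v).filter fun J => k ≤ 4 * J.card).biUnion fun J =>
          (Finset.powersetCard m (Finset.univ : Finset (TorusBond N))).filter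
            (J ⊆ ·)).card : ℕ) : ℝ) := by exact_mod_cast Finset.card_biUnion_le
    _ ≤ ∑ k ∈ Finset.Ico L (8 * N ^ 2), (N ^ 2 * ((1 / 2) ^ L * C) : ℝ) :=
        Finset.sum_le_sum hstart
    _ ≤ (8 * N ^ 2) * (N ^ 2 * ((1 / 2) ^ L * C)) := by
        rw [Finset.sum_const, nsmul_eq_mul, Nat.card_Ico]
        refine mul_le_mul_of_nonneg_right ?_ (by positivity)
        exact_mod_cast Nat.sub_le _ _
    _ = 8 * N ^ 4 * (1 / 2) ^ L * C := by ring

lemma badClassTrans_proportion_le {p : ℝ} (hp0 : 0 ≤ p) (hp : p ≤ 1 / 16 ^ 4) (lam : ℝ) (N : ℕ)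
    [NeZero N] :
    (Nat.card (badClassTrans p lam N) : ℝ) / (Nat.card (spinClass p N) : ℝ) ≤
      8 * N ^ 4 * (1 / 2) ^ ⌈lam * N⌉₊ := by
  refine div_le_of_le_mul₀ (by positivity) (by positivity) ?_
  have hm : ((⌊2 * p * (N : ℝ) ^ 2⌋₊ : ℕ) : ℝ) ≤ p * (2 * N ^ 2 : ℕ) := by
    refine (Nat.floor_le (by positivity)).trans (le_of_eq ?_)
    push_cast
    ring
  rw [card_spinClass]
  refine le_trans ?_ (card_badBondSets_le hp0 hp N _ hm)
  rw [Nat.card_coe_set_eq, ← Set.ncard_coe_finset]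
  exact_mod_cast (Set.ncard_le_ncard (badClassTrans_subset_image p lam N)
    ((Finset.finite_toSet _).image _)).trans (Set.ncard_image_le (Finset.finite_toSet _))

/-- There exists `p₀ > 0` such that for every `p ∈ (0, p₀)` and `λ ∈ (0,1)`, the proportion
`#ℬ̃^λ_p(N) / #𝒞_p(N)` of `N`-periodic spin systems with `⌊2pN²⌋` antiferromagnetic bonds per
cell admitting a separating path of length `≥ λN` with vertices in some translated cell
`z + [0,N]²`, `z ∈ ℤ²`, tends to `0` as `N → ∞`. -/
theorem bad_translated_proportion_tendsto_zero :
    ∃ p₀ : ℝ, 0 < p₀ ∧ ∀ p : ℝ, 0 < p → p < p₀ → ∀ lam : ℝ, 0 < lam → lam < 1 →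
      Filter.Tendsto
        (fun N : ℕ =>
          (Nat.card (badClassTrans p lam N) : ℝ) / (Nat.card (spinClass p N) : ℝ))
        Filter.atTop (nhds 0) := by
  refine ⟨1 / 16 ^ 4, by norm_num, fun p hp0 hp lam hlam _ => ?_⟩
  set r : ℝ := (1 / 2 : ℝ) ^ lam with hr
  have hr0 : 0 ≤ r := by positivity
  have hr1 : r < 1 := Real.rpow_lt_one (by norm_num) (by norm_num) hlam
  have hlim : Tendsto (fun N : ℕ => 8 * ((N : ℝ) ^ 4 * r ^ N)) atTop (nhds 0) := by
    simpa using (tendsto_pow_const_mul_const_pow_of_abs_lt_one 4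
      (by rwa [abs_of_nonneg hr0])).const_mul (8 : ℝ)
  refine squeeze_zero' (.of_forall fun N => by positivity) ?_ hlim
  filter_upwards [eventually_gt_atTop 0] with N hN
  have : NeZero N := ⟨hN.ne'⟩
  refine (badClassTrans_proportion_le hp0.le hp.le lam N).trans ?_
  have hpow : (1 / 2 : ℝ) ^ ⌈lam * N⌉₊ ≤ r ^ N := by
    rw [hr, ← Real.rpow_mul_natCast (by norm_num), ← Real.rpow_natCast]
    exact Real.rpow_le_rpow_of_exponent_ge (by norm_num) (by norm_num) (Nat.le_ceil _)
  rw [mul_assoc]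
  gcongr
end
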